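/- Let n₁, n₂ ≥ 1, n = n₁n₂, let y be an image over ZMod n₁ × ZMod n₂, and let M be the Moore–Penrose pseudoinverse of the two-dimensional discrete periodic divergence div. Writing M y = (u, w) as a pair of fields, let s = max of all entries of u and w, and t = min of all entries of u and w. Then λ_max := sInf {‖(v, w)‖_∞ : div(v, w) = y − ȳ𝟙} satisfies λ_max ≤ (s − t)/2. -/

import Mathlib

/-- Discrete periodic divergence in 2D as a linear map from pairs of fields to images:
`(div (v, w))_{i,j} = v_{i-1,j} - v_{i,j} + w_{i,j-1} - w_{i,j}`. -/
noncomputable def div2L (n₁ n₂ : ℕ) :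
    ((ZMod n₁ × ZMod n₂ → ℝ) × (ZMod n₁ × ZMod n₂ → ℝ)) →ₗ[ℝ]
      (ZMod n₁ × ZMod n₂ → ℝ) where
  toFun vw := fun p => vw.1 (p.1 - 1, p.2) - vw.1 p + (vw.2 (p.1, p.2 - 1) - vw.2 p)
  map_add' a b := by
    funext p
    simp only [Prod.fst_add, Prod.snd_add, Pi.add_apply]
    ring
  map_smul' c a := by
    funext p
    simp only [Prod.smul_fst, Prod.smul_snd, Pi.smul_apply, smul_eq_mul, RingHom.id_apply]
    ring

/-- Standard inner product on images. -/
noncomputable def dotIm (n₁ n₂ : ℕ) [NeZero n₁] [NeZero n₂]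
    (u v : ZMod n₁ × ZMod n₂ → ℝ) : ℝ := ∑ p, u p * v p

/-- Standard inner product on pairs of fields. -/
noncomputable def dotPair (n₁ n₂ : ℕ) [NeZero n₁] [NeZero n₂]
    (a b : (ZMod n₁ × ZMod n₂ → ℝ) × (ZMod n₁ × ZMod n₂ → ℝ)) : ℝ :=
  ∑ p, (a.1 p * b.1 p + a.2 p * b.2 p)

/-- Mean of an image indexed by `ZMod n₁ × ZMod n₂`. -/
noncomputable def mean2 (n₁ n₂ : ℕ) [NeZero n₁] [NeZero n₂]
    (y : ZMod n₁ × ZMod n₂ → ℝ) : ℝ :=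
  (∑ p, y p) / (n₁ * n₂)

/-- Sup norm of a pair of fields: maximum over all entries of `|v_{i,j}|`, `|w_{i,j}|`. -/
noncomputable def normInf2 (n₁ n₂ : ℕ) [NeZero n₁] [NeZero n₂]
    (vw : (ZMod n₁ × ZMod n₂ → ℝ) × (ZMod n₁ × ZMod n₂ → ℝ)) : ℝ :=
  max (Finset.univ.sup' Finset.univ_nonempty fun p => |vw.1 p|)
    (Finset.univ.sup' Finset.univ_nonempty fun p => |vw.2 p|)

theorem sum_shift1 (n₁ n₂ : ℕ) [NeZero n₁] [NeZero n₂] (f : ZMod n₁ × ZMod n₂ → ℝ) :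
    ∑ p : ZMod n₁ × ZMod n₂, f (p.1 - 1, p.2) = ∑ p, f p :=
  Fintype.sum_equiv ((Equiv.subRight (1 : ZMod n₁)).prodCongr (Equiv.refl _)) _ _ (fun _ => rfl)

theorem sum_shift2 (n₁ n₂ : ℕ) [NeZero n₁] [NeZero n₂] (f : ZMod n₁ × ZMod n₂ → ℝ) :
    ∑ p : ZMod n₁ × ZMod n₂, f (p.1, p.2 - 1) = ∑ p, f p :=
  Fintype.sum_equiv ((Equiv.refl _).prodCongr (Equiv.subRight (1 : ZMod n₂))) _ _ (fun _ => rfl)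

theorem sum_div2 (n₁ n₂ : ℕ) [NeZero n₁] [NeZero n₂]
    (a : (ZMod n₁ × ZMod n₂ → ℝ) × (ZMod n₁ × ZMod n₂ → ℝ)) :
    ∑ p, div2L n₁ n₂ a p = 0 := by
  simp only [div2L, LinearMap.coe_mk, AddHom.coe_mk, Finset.sum_add_distrib,
    Finset.sum_sub_distrib, sum_shift1 n₁ n₂ a.1, sum_shift2 n₁ n₂ a.2]
  ring

theorem const_of_orth (n₁ n₂ : ℕ) [NeZero n₁] [NeZero n₂] (r : ZMod n₁ × ZMod n₂ → ℝ)
    (h : ∀ a, ∑ p, r p * div2L n₁ n₂ a p = 0) (p : ZMod n₁ × ZMod n₂) : r p = r (0, 0) := by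
  classical
  have e1 : ∀ i j, r (i + 1, j) = r (i, j) := by
    intro i j
    have := h (Pi.single (i, j) 1, 0)
    have h' := sum_shift1 n₁ n₂ (fun p => r (p.1 + 1, p.2) * (Pi.single (i, j) 1 : _ → ℝ) p)
    simp only [sub_add_cancel] at h'
    simp only [div2L, LinearMap.coe_mk, AddHom.coe_mk, Pi.zero_apply, sub_zero, add_zero,
      mul_sub, Finset.sum_sub_distrib] at this
    rw [h'] at this
    simp [Pi.single_apply] at this
    linarith
  have e2 : ∀ i j, r (i, j + 1) = r (i, j) := by
    intro i j
    have := h (0, Pi.single (i, j) 1)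
    have h' := sum_shift2 n₁ n₂ (fun p => r (p.1, p.2 + 1) * (Pi.single (i, j) 1 : _ → ℝ) p)
    simp only [sub_add_cancel] at h'
    simp only [div2L, LinearMap.coe_mk, AddHom.coe_mk, Pi.zero_apply, sub_zero, zero_add,
      mul_sub, Finset.sum_sub_distrib] at this
    rw [h'] at this
    simp [Pi.single_apply] at this
    linarith
  have f1 : ∀ (k : ℕ) j, r ((k : ZMod n₁), j) = r (0, j) := by
    intro k j
    induction k with
    | zero => simp
    | succ k ih => rw [Nat.cast_succ, e1, ih]
  have f2 : ∀ (k : ℕ) i, r (i, (k : ZMod n₂)) = r (i, 0) := by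
    intro k i
    induction k with
    | zero => simp
    | succ k ih => rw [Nat.cast_succ, e2, ih]
  obtain ⟨i, j⟩ := p
  rw [← ZMod.natCast_zmod_val i, f1, ← ZMod.natCast_zmod_val j, f2]

theorem stmt12 (n₁ n₂ : ℕ) [NeZero n₁] [NeZero n₂] (hn₁ : 1 ≤ n₁) (hn₂ : 1 ≤ n₂)
    (y : ZMod n₁ × ZMod n₂ → ℝ)
    (M : (ZMod n₁ × ZMod n₂ → ℝ) →ₗ[ℝ]
      ((ZMod n₁ × ZMod n₂ → ℝ) × (ZMod n₁ × ZMod n₂ → ℝ)))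
    (h1 : div2L n₁ n₂ ∘ₗ M ∘ₗ div2L n₁ n₂ = div2L n₁ n₂)
    (h2 : M ∘ₗ div2L n₁ n₂ ∘ₗ M = M)
    (h3 : ∀ u v : ZMod n₁ × ZMod n₂ → ℝ,
      dotIm n₁ n₂ (div2L n₁ n₂ (M u)) v = dotIm n₁ n₂ u (div2L n₁ n₂ (M v)))
    (h4 : ∀ a b : (ZMod n₁ × ZMod n₂ → ℝ) × (ZMod n₁ × ZMod n₂ → ℝ),
      dotPair n₁ n₂ (M (div2L n₁ n₂ a)) b = dotPair n₁ n₂ a (M (div2L n₁ n₂ b)))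
    (s t : ℝ)
    (hs : s = max (Finset.univ.sup' Finset.univ_nonempty fun p => (M y).1 p)
      (Finset.univ.sup' Finset.univ_nonempty fun p => (M y).2 p))
    (ht : t = min (Finset.univ.inf' Finset.univ_nonempty fun p => (M y).1 p)
      (Finset.univ.inf' Finset.univ_nonempty fun p => (M y).2 p)) :
    sInf {r : ℝ | ∃ vw : (ZMod n₁ × ZMod n₂ → ℝ) × (ZMod n₁ × ZMod n₂ → ℝ),
        div2L n₁ n₂ vw = (fun p => y p - mean2 n₁ n₂ y) ∧ r = normInf2 n₁ n₂ vw} ≤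
      (s - t) / 2 := by
  have hdiv : div2L n₁ n₂ (M y) = fun p => y p - mean2 n₁ n₂ y := by
    have hc := const_of_orth n₁ n₂ (fun p => y p - div2L n₁ n₂ (M y) p) (by
      intro a
      have e := h3 y (div2L n₁ n₂ a)
      have e1 : div2L n₁ n₂ (M (div2L n₁ n₂ a)) = div2L n₁ n₂ a := LinearMap.congr_fun h1 a
      rw [e1] at e
      unfold dotIm at e
      simp only [sub_mul, Finset.sum_sub_distrib]
      linarith)
    set c := (fun p => y p - div2L n₁ n₂ (M y) p) (0, 0) with hcdef
    have hy : ∑ p, y p = (n₁ * n₂ : ℝ) * c := by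
      have h5 : ∑ p, (y p - div2L n₁ n₂ (M y) p) = ∑ _p : ZMod n₁ × ZMod n₂, c :=
        Finset.sum_congr rfl (fun p _ => hc p)
      rw [Finset.sum_sub_distrib, sum_div2] at h5
      simpa [ZMod.card] using h5
    have hm : mean2 n₁ n₂ y = c := by
      unfold mean2
      rw [hy]
      have : (n₁ : ℝ) ≠ 0 := Nat.cast_ne_zero.mpr (NeZero.ne n₁)
      have : (n₂ : ℝ) ≠ 0 := Nat.cast_ne_zero.mpr (NeZero.ne n₂)
      field_simp
    funext p
    have := hc p
    rw [hm]
    linarith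
  have hs1 : ∀ p, (M y).1 p ≤ s := fun p => by
    rw [hs]
    exact le_max_of_le_left (Finset.le_sup' (fun p => (M y).1 p) (Finset.mem_univ p))
  have hs2 : ∀ p, (M y).2 p ≤ s := fun p => by
    rw [hs]
    exact le_max_of_le_right (Finset.le_sup' (fun p => (M y).2 p) (Finset.mem_univ p))
  have ht1 : ∀ p, t ≤ (M y).1 p := fun p => by
    rw [ht]
    exact min_le_of_left_le (Finset.inf'_le (fun p => (M y).1 p) (Finset.mem_univ p))
  have ht2 : ∀ p, t ≤ (M y).2 p := fun p => by
    rw [ht]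
    exact min_le_of_right_le (Finset.inf'_le (fun p => (M y).2 p) (Finset.mem_univ p))
  let vw : (ZMod n₁ × ZMod n₂ → ℝ) × (ZMod n₁ × ZMod n₂ → ℝ) :=
    (fun p => (M y).1 p - (s + t) / 2, fun p => (M y).2 p - (s + t) / 2)
  have hvw : div2L n₁ n₂ vw = fun p => y p - mean2 n₁ n₂ y := by
    rw [← hdiv]
    funext p
    simp only [div2L, LinearMap.coe_mk, AddHom.coe_mk, vw]
    ring
  refine le_trans (csInf_le ⟨0, ?_⟩ ⟨vw, hvw, rfl⟩) ?_
  · rintro r ⟨a, -, rfl⟩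
    exact le_max_of_le_left (le_trans (abs_nonneg (a.1 0))
      (Finset.le_sup' (fun p => |a.1 p|) (Finset.mem_univ 0)))
  · refine max_le (Finset.sup'_le _ _ fun p _ => ?_) (Finset.sup'_le _ _ fun p _ => ?_)
    · have := hs1 p
      have := ht1 p
      simp only [vw]
      rw [abs_le]
      constructor <;> linarith
    · have := hs2 p
      have := ht2 p
      simp only [vw]
      rw [abs_le]
      constructor <;> linarith
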